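/- Let θ ∈ (1/2, 1] and suppose all ratios satisfy 0 < r_k ≤ r_s, the unique positive root of (1 − 2θ)² r³ − 4θ² r² − 4θ r − 1 = 0. Let u : [0, T] → H be three times continuously differentiable and satisfy u'(t) + A u(t) = f(t) for all t ∈ [0, T], and let u^0, …, u^N be the WSBDF2 approximations with u^0 = u(0) and f^k := f(t_k). Then for every 1 ≤ n ≤ N, ‖u(t_n) − u^n‖ ≤ 4(2 − θ) τ_max² · max_{0 ≤ t ≤ t_1} ‖u''(t)‖ + 6 t_n τ_max² · max_{0 ≤ t ≤ T} ‖u'''(t)‖, where τ_max := max_{1 ≤ k ≤ N} τ_k; in particular the scheme is second-order convergent in norm. -/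

import Mathlib

open Finset

/-- Adjacent time-step ratios `r_k = τ_k / τ_{k-1}`. -/
noncomputable def rr (τ : ℕ → ℝ) (k : ℕ) : ℝ := τ k / τ (k - 1)

/-- The WSBDF2 convolution kernels `b_j^{(n)}`:
`b_0^{(1)} = 1/τ_1`, and for `n ≥ 2`,
`b_0^{(n)} = (1 + 2θ r_n)/(τ_n (1 + r_n))`, `b_1^{(n)} = (1 - 2θ) r_n² /(τ_n (1 + r_n))`,
all other kernels vanish. -/
noncomputable def bk (θ : ℝ) (τ : ℕ → ℝ) (n j : ℕ) : ℝ :=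
  if n = 1 then (if j = 0 then 1 / τ 1 else 0)
  else if j = 0 then (1 + 2 * θ * rr τ n) / (τ n * (1 + rr τ n))
  else if j = 1 then (1 - 2 * θ) * (rr τ n) ^ 2 / (τ n * (1 + rr τ n))
  else 0

/-- The DOC (discrete orthogonal convolution) kernels: `dk θ τ n m` is `d_m^{(n)}`,
defined by `d_0^{(n)} = 1/b_0^{(n)}` and
`d_{n-k}^{(n)} = -(b_1^{(k+1)}/b_0^{(k)}) d_{n-k-1}^{(n)}` for `1 ≤ k ≤ n-1`. -/
noncomputable def dk (θ : ℝ) (τ : ℕ → ℝ) (n : ℕ) : ℕ → ℝ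
  | 0 => 1 / bk θ τ n 0
  | m + 1 => -(bk θ τ (n - m) 1 / bk θ τ (n - m - 1) 0) * dk θ τ n m

open scoped RealInnerProductSpace


/-- The solution `y` of the lower bidiagonal system `b_0^{(n)} y^n + b_1^{(n)} y^{n-1} = x^n`
with `y^0 = 0`, i.e. the convolution of `x` with the DOC kernels. -/
noncomputable def docTransform {H : Type*} [AddCommGroup H] [Module ℝ H]
    (θ : ℝ) (τ : ℕ → ℝ) (x : ℕ → H) : ℕ → H
  | 0 => 0
  | n + 1 => (bk θ τ (n + 1) 0)⁻¹ • (x (n + 1) - bk θ τ (n + 1) 1 • docTransform θ τ x n)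

section Kernels

variable {θ : ℝ} {τ : ℕ → ℝ}

theorem bk_one_zero : bk θ τ 1 0 = 1 / τ 1 := by simp [bk]

theorem bk_one_one : bk θ τ 1 1 = 0 := by simp [bk]

theorem bk_zero_of_two_le {n : ℕ} (hn : 2 ≤ n) :
    bk θ τ n 0 = (1 + 2 * θ * rr τ n) / (τ n * (1 + rr τ n)) := by
  simp [bk, show n ≠ 1 by omega]

theorem bk_one_of_two_le {n : ℕ} (hn : 2 ≤ n) :
    bk θ τ n 1 = (1 - 2 * θ) * (rr τ n) ^ 2 / (τ n * (1 + rr τ n)) := by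
  simp [bk, show n ≠ 1 by omega]

theorem bk_zero_pos (hθ : 0 ≤ θ) {n : ℕ} (hn : 1 ≤ n) (hτ : 0 < τ n)
    (hr : 2 ≤ n → 0 < rr τ n) : 0 < bk θ τ n 0 := by
  rcases hn.eq_or_lt with rfl | h
  · rw [bk_one_zero]; positivity
  · have := hr h
    rw [bk_zero_of_two_le h]; positivity

theorem bk_docTransform {H : Type*} [AddCommGroup H] [Module ℝ H] (x : ℕ → H) {n : ℕ}
    (h : bk θ τ (n + 1) 0 ≠ 0) :
    bk θ τ (n + 1) 0 • docTransform θ τ x (n + 1) + bk θ τ (n + 1) 1 • docTransform θ τ x n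
      = x (n + 1) := by
  rw [docTransform, smul_inv_smul₀ h, sub_add_cancel]

theorem rr_mul {n : ℕ} (h : τ (n - 1) ≠ 0) : rr τ n * τ (n - 1) = τ n := by
  rw [rr, div_mul_cancel₀ _ h]

/-- First-order consistency of the kernels. -/
theorem bk_zero_mul_add {n : ℕ} (hn : 2 ≤ n) (hτ : 0 < τ n) (hτ' : 0 < τ (n - 1)) :
    bk θ τ n 0 * τ n + bk θ τ n 1 * τ (n - 1) = 1 := by
  have hr : 0 < rr τ n := div_pos hτ hτ'
  have h := rr_mul (τ := τ) hτ'.ne'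
  rw [bk_zero_of_two_le hn, bk_one_of_two_le hn]
  generalize rr τ n = r at *
  rw [← h]
  field_simp
  ring

/-- Second-order consistency of the kernels. -/
theorem bk_zero_mul_sq_sub {n : ℕ} (hn : 2 ≤ n) (hτ : 0 < τ n) (hτ' : 0 < τ (n - 1)) :
    bk θ τ n 0 * τ n ^ 2 - bk θ τ n 1 * τ (n - 1) ^ 2 = 2 * θ * τ n := by
  have hr : 0 < rr τ n := div_pos hτ hτ'
  have h := rr_mul (τ := τ) hτ'.ne'
  rw [bk_zero_of_two_le hn, bk_one_of_two_le hn]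
  generalize rr τ n = r at *
  rw [← h]
  field_simp
  ring

theorem bk_one_nonpos (hθ : 1 / 2 ≤ θ) {n : ℕ} (hn : 2 ≤ n) (hτ : 0 < τ n)
    (hr : 0 < rr τ n) : bk θ τ n 1 ≤ 0 := by
  rw [bk_one_of_two_le hn]
  apply div_nonpos_of_nonpos_of_nonneg
  · exact mul_nonpos_of_nonpos_of_nonneg (by linarith) (sq_nonneg _)
  · positivity

/-- Geometric decay of the off-diagonal kernel relative to the diagonal one. -/
theorem neg_bk_one_mul_le (hθ : 1 / 2 ≤ θ) {n : ℕ} (hn : 2 ≤ n) (hτ : 0 < τ n)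
    (hτ' : 0 < τ (n - 1)) :
    -bk θ τ n 1 * τ (n - 1) ≤ bk θ τ n 0 * (τ n * ((2 * θ - 1) / (2 * θ))) := by
  have hr : 0 < rr τ n := div_pos hτ hτ'
  have h := rr_mul (τ := τ) hτ'.ne'
  rw [bk_zero_of_two_le hn, bk_one_of_two_le hn]
  generalize rr τ n = r at *
  rw [← h, ← sub_nonneg]
  have : (1 + 2 * θ * r) / (r * τ (n - 1) * (1 + r)) * (r * τ (n - 1) * ((2 * θ - 1) / (2 * θ))) -
      -((1 - 2 * θ) * r ^ 2 / (r * τ (n - 1) * (1 + r))) * τ (n - 1)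
      = (2 * θ - 1) / (2 * θ * (1 + r)) := by
    field_simp
    ring
  rw [this]
  exact div_nonneg (by linarith) (by positivity)

/-- The cubic inequality behind the step-ratio bound. -/
theorem sq_mul_cube_le_of_le_root (hθ : 1 / 2 < θ ∧ θ ≤ 1) {rs r g : ℝ} (hrs : 0 < rs)
    (hroot : (1 - 2 * θ) ^ 2 * rs ^ 3 - 4 * θ ^ 2 * rs ^ 2 - 4 * θ * rs - 1 = 0)
    (hr : 0 < r) (hle : r ≤ rs) (hg : g = (1 + 2 * θ * rs) / (2 * (1 + rs))) :
    (1 - 2 * θ) ^ 2 * r ^ 3 ≤ 4 * g * (1 + r) * (1 + 2 * θ * r - g * (1 + r)) := by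
  obtain ⟨h1, h2⟩ := hθ
  have hg0 : 0 < g := by rw [hg]; positivity
  have hg1 : g ≤ θ := by
    rw [hg, div_le_iff₀ (by positivity)]; nlinarith
  have hgs : 2 * g * (1 + rs) = 1 + 2 * θ * rs := by rw [hg]; field_simp
  have hP : (1 - 2 * θ) ^ 2 * rs ^ 3
      = 4 * g * (2 * θ - g) * rs ^ 2 + 4 * g * (1 + 2 * θ - 2 * g) * rs + 4 * g * (1 - g) := by
    linear_combination hroot + (2 * g * (1 + rs) - (1 + 2 * θ * rs)) * hgs
  have hα : 0 ≤ 4 * g * (2 * θ - g) := mul_nonneg (by positivity) (by linarith)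
  have hβ : 0 ≤ 4 * g * (1 + 2 * θ - 2 * g) := mul_nonneg (by positivity) (by linarith)
  have hγ : 0 ≤ 4 * g * (1 - g) := mul_nonneg (by positivity) (by linarith)
  have e1 : r ^ 3 * rs ^ 2 ≤ rs ^ 3 * r ^ 2 := by
    nlinarith [mul_le_mul_of_nonneg_left hle (by positivity : 0 ≤ r ^ 2 * rs ^ 2)]
  have e2 : r ^ 3 * rs ≤ rs ^ 3 * r := by
    have := pow_le_pow_left₀ hr.le hle 2
    nlinarith [mul_le_mul_of_nonneg_left this (by positivity : 0 ≤ r * rs)]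
  have e3 : r ^ 3 ≤ rs ^ 3 := pow_le_pow_left₀ hr.le hle 3
  have : rs ^ 3 * ((1 - 2 * θ) ^ 2 * r ^ 3) ≤
      rs ^ 3 * (4 * g * (1 + r) * (1 + 2 * θ * r - g * (1 + r))) := by
    calc rs ^ 3 * ((1 - 2 * θ) ^ 2 * r ^ 3)
        = 4 * g * (2 * θ - g) * (r ^ 3 * rs ^ 2) + 4 * g * (1 + 2 * θ - 2 * g) * (r ^ 3 * rs)
          + 4 * g * (1 - g) * r ^ 3 := by linear_combination r ^ 3 * hP
      _ ≤ 4 * g * (2 * θ - g) * (rs ^ 3 * r ^ 2) + 4 * g * (1 + 2 * θ - 2 * g) * (rs ^ 3 * r)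
          + 4 * g * (1 - g) * rs ^ 3 := by gcongr
      _ = _ := by ring
  exact le_of_mul_le_mul_left this (by positivity)

theorem bk_one_sq_le (hθ : 1 / 2 < θ ∧ θ ≤ 1) {rs g : ℝ} (hrs : 0 < rs)
    (hroot : (1 - 2 * θ) ^ 2 * rs ^ 3 - 4 * θ ^ 2 * rs ^ 2 - 4 * θ * rs - 1 = 0)
    (hg : g = (1 + 2 * θ * rs) / (2 * (1 + rs))) {n : ℕ} (hn : 2 ≤ n) (hτ : 0 < τ n)
    (hτ' : 0 < τ (n - 1)) (hle : rr τ n ≤ rs) :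
    bk θ τ n 1 ^ 2 ≤ 4 * (bk θ τ n 0 - g / τ n) * (g / τ (n - 1)) := by
  have hr : 0 < rr τ n := div_pos hτ hτ'
  have h := rr_mul (τ := τ) hτ'.ne'
  have key := sq_mul_cube_le_of_le_root hθ hrs hroot hr hle hg
  rw [bk_zero_of_two_le hn, bk_one_of_two_le hn]
  generalize rr τ n = r at *
  rw [← h, ← sub_nonneg]
  have : 4 * ((1 + 2 * θ * r) / (r * τ (n - 1) * (1 + r)) - g / (r * τ (n - 1))) *
      (g / τ (n - 1)) - ((1 - 2 * θ) * r ^ 2 / (r * τ (n - 1) * (1 + r))) ^ 2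
      = (4 * g * (1 + r) * (1 + 2 * θ * r - g * (1 + r)) - (1 - 2 * θ) ^ 2 * r ^ 3) /
        (r * τ (n - 1) ^ 2 * (1 + r) ^ 2) := by
    field_simp
  rw [this]
  exact div_nonneg (by linarith) (by positivity)

end Kernels

section Stability

variable {H : Type*} [NormedAddCommGroup H] [InnerProductSpace ℝ H]

/-- A form `p ‖v‖² + b ⟨v, w⟩ + s ‖w‖²` in the `A`-semi-inner product is nonnegative when its
discriminant is nonpositive. -/
theorem quadratic_form_nonneg (A : H →L[ℝ] H) (hA : ∀ x y : H, ⟪A x, y⟫ = ⟪x, A y⟫)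
    (hA0 : ∀ x : H, 0 ≤ ⟪A x, x⟫) {p b s : ℝ} (hs : 0 < s) (h : b ^ 2 ≤ 4 * p * s) (v w : H) :
    0 ≤ p * ⟪A v, v⟫ + b * ⟪A v, w⟫ + s * ⟪A w, w⟫ := by
  have h1 := hA0 (s • w + (b / 2) • v)
  have hsymm : ⟪A w, v⟫ = ⟪A v, w⟫ := by rw [hA, real_inner_comm]
  simp only [map_add, map_smul, inner_add_left, inner_add_right, real_inner_smul_left,
    real_inner_smul_right, hsymm] at h1
  have h2 := mul_nonneg (by linarith : 0 ≤ 4 * p * s - b ^ 2) (hA0 v)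
  have : 0 ≤ s * (p * ⟪A v, v⟫ + b * ⟪A v, w⟫ + s * ⟪A w, w⟫) := by nlinarith
  exact nonneg_of_mul_nonneg_right this hs

theorem norm_sq_sub_le_inner {θ : ℝ} (hθ : 1 / 2 ≤ θ) (x y : H) :
    ‖x‖ ^ 2 - ‖y‖ ^ 2 ≤ 2 * ⟪x - y, θ • x + (1 - θ) • y⟫ := by
  have h := real_inner_self_nonneg (x := x - y)
  simp only [inner_sub_left, inner_sub_right, inner_add_right, real_inner_smul_right,
    real_inner_comm x y, real_inner_self_eq_norm_sq] at h ⊢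
  nlinarith

theorem bk_energy_step {θ : ℝ} (hθ : 1 / 2 < θ ∧ θ ≤ 1) {τ : ℕ → ℝ} {N : ℕ}
    (hτ : ∀ k, 1 ≤ k → k ≤ N → 0 < τ k) {rs g : ℝ} (hrs : 0 < rs)
    (hroot : (1 - 2 * θ) ^ 2 * rs ^ 3 - 4 * θ ^ 2 * rs ^ 2 - 4 * θ * rs - 1 = 0)
    (hg : g = (1 + 2 * θ * rs) / (2 * (1 + rs)))
    (hr : ∀ k, 2 ≤ k → k ≤ N → rr τ k ≤ rs)
    (A : H →L[ℝ] H) (hA : ∀ x y : H, ⟪A x, y⟫ = ⟪x, A y⟫) (hA0 : ∀ x : H, 0 ≤ ⟪A x, x⟫)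
    {v : ℕ → H} (hv0 : v 0 = 0) {n : ℕ} (hn : n + 1 ≤ N) :
    g / τ (n + 1) * ⟪A (v (n + 1)), v (n + 1)⟫ - g / τ n * ⟪A (v n), v n⟫ ≤
      ⟪A (v (n + 1)), bk θ τ (n + 1) 0 • v (n + 1) + bk θ τ (n + 1) 1 • v n⟫ := by
  have hg0 : 0 < g := by have := hθ.1; rw [hg]; positivity
  rw [inner_add_right, real_inner_smul_right, real_inner_smul_right]
  rcases Nat.eq_zero_or_pos n with rfl | hn0
  · have hg1 : g ≤ 1 := by
      rw [hg, div_le_iff₀ (by positivity)]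
      nlinarith [hθ.1, hθ.2]
    have := hτ 1 le_rfl hn
    have h2 : g / τ 1 ≤ 1 / τ 1 := by gcongr
    simp only [zero_add, hv0, bk_one_zero, map_zero, inner_zero_right]
    nlinarith [mul_le_mul_of_nonneg_right h2 (hA0 (v 1))]
  · have h1 := hτ (n + 1) (by omega) hn
    have h2 := hτ n hn0 (by omega)
    have hb := bk_one_sq_le (τ := τ) hθ hrs hroot hg (n := n + 1) (by omega) h1 h2
      (hr _ (by omega) hn)
    have := quadratic_form_nonneg A hA hA0 (div_pos hg0 h2) hb (v (n + 1)) (v n)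
    linarith

/-- Stability: the solution of the scheme is controlled by the DOC transform of the
right-hand side. -/
theorem norm_le_two_mul_sum_docTransform {θ : ℝ} (hθ : 1 / 2 < θ ∧ θ ≤ 1) {τ : ℕ → ℝ} {N : ℕ}
    (hτ : ∀ k, 1 ≤ k → k ≤ N → 0 < τ k) {rs : ℝ} (hrs : 0 < rs)
    (hroot : (1 - 2 * θ) ^ 2 * rs ^ 3 - 4 * θ ^ 2 * rs ^ 2 - 4 * θ * rs - 1 = 0)
    (hr : ∀ k, 2 ≤ k → k ≤ N → 0 < rr τ k ∧ rr τ k ≤ rs)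
    (A : H →L[ℝ] H) (hA : ∀ x y : H, ⟪A x, y⟫ = ⟪x, A y⟫) (hA0 : ∀ x : H, 0 ≤ ⟪A x, x⟫)
    {e ξ : ℕ → H} (he0 : e 0 = 0)
    (he : ∀ n, n + 1 ≤ N → bk θ τ (n + 1) 0 • (e (n + 1) - e n)
      + bk θ τ (n + 1) 1 • (e n - e (n - 1)) + A (θ • e (n + 1) + (1 - θ) • e n) = ξ (n + 1))
    {n : ℕ} (hn : n ≤ N) :
    ‖e n‖ ≤ 2 * ∑ k ∈ range n, ‖docTransform θ τ ξ (k + 1)‖ := by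
  set g : ℝ := (1 + 2 * θ * rs) / (2 * (1 + rs)) with hg
  have hg0 : 0 < g := by have := hθ.1; positivity
  set v := docTransform θ τ (fun k => θ • e k + (1 - θ) • e (k - 1)) with hv
  set η := docTransform θ τ ξ with hη
  have hb : ∀ n, n + 1 ≤ N → bk θ τ (n + 1) 0 ≠ 0 := fun n hn =>
    (bk_zero_pos (by linarith [hθ.1]) (by omega) (hτ _ (by omega) hn)
      (fun h => (hr _ h hn).1)).ne'
  have hD : ∀ n, n ≤ N → e n - e (n - 1) = η n - A (v n) := by
    intro n
    induction n with
    | zero => intro _; simp [hη, hv, docTransform]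
    | succ n ih =>
      intro hn
      have h1 := he n hn
      have h2 := bk_docTransform (θ := θ) (τ := τ) ξ (hb n hn)
      have h3 := bk_docTransform (θ := θ) (τ := τ) (fun k => θ • e k + (1 - θ) • e (k - 1))
        (hb n hn)
      simp only [← hv, ← hη, Nat.add_sub_cancel] at h2 h3
      rw [ih (by omega), ← h2, ← h3] at h1
      simp only [map_add, map_smul] at h1
      apply smul_right_injective H (hb n hn)
      simp only [Nat.add_sub_cancel]
      linear_combination (norm := module) h1
  set E : ℕ → ℝ := fun n => ‖e n‖ ^ 2 + 2 * (g / τ n * ⟪A (v n), v n⟫) with hE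
  have hEe : ∀ n, n ≤ N → ‖e n‖ ^ 2 ≤ E n := by
    intro n hn
    rcases Nat.eq_zero_or_pos n with rfl | h
    · simp [hE, hv, docTransform]
    · have := mul_nonneg (div_pos hg0 (hτ n h hn)).le (hA0 (v n))
      simp only [hE]; linarith
  have hstep : ∀ n, n + 1 ≤ N → √(E (n + 1)) ≤ √(E n) + 2 * ‖η (n + 1)‖ := by
    intro n hn
    have h3 := bk_docTransform (θ := θ) (τ := τ) (fun k => θ • e k + (1 - θ) • e (k - 1))
      (hb n hn)
    simp only [← hv, Nat.add_sub_cancel] at h3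
    have h4 := bk_energy_step hθ hτ hrs hroot hg (fun k h h' => (hr k h h').2) A hA hA0
      (v := v) (by simp [hv, docTransform]) hn
    rw [h3] at h4
    have h5 := norm_sq_sub_le_inner hθ.1.le (e (n + 1)) (e n)
    have h6 := hD (n + 1) hn
    simp only [Nat.add_sub_cancel] at h6
    rw [h6, inner_sub_left] at h5
    have hn0 : 0 ≤ E n := (sq_nonneg _).trans (hEe n (by omega))
    have hn1 : 0 ≤ E (n + 1) := (sq_nonneg _).trans (hEe (n + 1) hn)
    have h7 : ‖e n‖ ≤ √(E n) := Real.le_sqrt_of_sq_le (hEe n (by omega))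
    have h8 : ‖e (n + 1)‖ ≤ √(E (n + 1)) := Real.le_sqrt_of_sq_le (hEe (n + 1) hn)
    have h9 : ‖θ • e (n + 1) + (1 - θ) • e n‖ ≤ √(E (n + 1)) + √(E n) := by
      refine (norm_add_le _ _).trans ?_
      rw [norm_smul, norm_smul, Real.norm_of_nonneg (by linarith [hθ.1] : 0 ≤ θ),
        Real.norm_of_nonneg (by linarith [hθ.2] : 0 ≤ 1 - θ)]
      nlinarith [norm_nonneg (e n), norm_nonneg (e (n + 1)), hθ.1, hθ.2]
    have h10 := (real_inner_le_norm (η (n + 1)) (θ • e (n + 1) + (1 - θ) • e n)).trans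
      (mul_le_mul_of_nonneg_left h9 (norm_nonneg _))
    have h11 : E (n + 1) ≤ E n + 2 * (‖η (n + 1)‖ * (√(E (n + 1)) + √(E n))) := by
      simp only [hE] at *
      linarith
    by_contra! hlt
    have hpos : 0 < √(E (n + 1)) + √(E n) := by
      linarith [Real.sqrt_nonneg (E n), norm_nonneg (η (n + 1))]
    nlinarith [Real.sq_sqrt hn0, Real.sq_sqrt hn1, mul_pos hpos (sub_pos.mpr hlt)]
  have hsum : ∀ n, n ≤ N → √(E n) ≤ 2 * ∑ k ∈ range n, ‖η (k + 1)‖ := by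
    intro n
    induction n with
    | zero => intro _; simp [hE, hv, docTransform, he0]
    | succ n ih =>
      intro hn
      rw [sum_range_succ]
      linarith [hstep n hn, ih (by omega)]
  exact (Real.le_sqrt_of_sq_le (hEe n hn)).trans (hsum n hn)

/-- The DOC transform of a sequence which is bounded from its second entry on. -/
theorem norm_docTransform_le {θ : ℝ} (hθ : 1 / 2 ≤ θ) {τ : ℕ → ℝ} {N : ℕ}
    (hτ : ∀ k, 1 ≤ k → k ≤ N → 0 < τ k) {ξ : ℕ → H} {X C : ℝ} (hC : 0 ≤ C)
    (h1 : ‖ξ 1‖ ≤ X) (h2 : ∀ k, 2 ≤ k → k ≤ N → ‖ξ k‖ ≤ C) {n : ℕ} (hn : n + 1 ≤ N) :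
    ‖docTransform θ τ ξ (n + 1)‖ ≤ τ (n + 1) * (C + ((2 * θ - 1) / (2 * θ)) ^ n * X) := by
  induction n with
  | zero =>
    have := hτ 1 le_rfl hn
    simp only [docTransform, zero_add, bk_one_zero, bk_one_one, smul_zero, sub_zero, pow_zero,
      one_mul, one_div, inv_inv, norm_smul, Real.norm_of_nonneg this.le]
    gcongr
    linarith
  | succ n ih =>
    have ih := ih (by omega)
    have hX : 0 ≤ X := (norm_nonneg _).trans h1
    have hp := hτ (n + 1 + 1) (by omega) hn
    have hp' := hτ (n + 1) (by omega) (by omega)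
    have hr : 0 < rr τ (n + 1 + 1) := div_pos hp hp'
    have hb := bk_zero_pos (τ := τ) (by linarith : 0 ≤ θ) (n := n + 1 + 1) (by omega) hp
      (fun _ => hr)
    have hb1 := bk_one_nonpos hθ (n := n + 1 + 1) (by omega) hp hr
    have hcons := bk_zero_mul_add (θ := θ) (n := n + 1 + 1) (by omega) hp hp'
    have hgeo := neg_bk_one_mul_le hθ (n := n + 1 + 1) (by omega) hp hp'
    simp only [Nat.add_sub_cancel] at hcons hgeo
    have hq : 0 ≤ (2 * θ - 1) / (2 * θ) := div_nonneg (by linarith) (by linarith)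
    rw [docTransform, norm_smul, Real.norm_of_nonneg (inv_nonneg.mpr hb.le),
      inv_mul_le_iff₀ hb]
    refine (norm_sub_le _ _).trans ?_
    rw [norm_smul, Real.norm_of_nonpos hb1]
    have h3 := mul_le_mul_of_nonneg_left ih (by linarith : 0 ≤ -bk θ τ (n + 1 + 1) 1)
    have h4 := mul_le_mul_of_nonneg_right hgeo (mul_nonneg (pow_nonneg hq n) hX)
    have h5 := h2 (n + 1 + 1) (by omega) hn
    rw [pow_succ]
    linear_combination h5 + h3 + h4 - C * hcons

theorem sum_norm_docTransform_le {θ : ℝ} (hθ : 1 / 2 ≤ θ) {τ : ℕ → ℝ} {N : ℕ}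
    (hτ : ∀ k, 1 ≤ k → k ≤ N → 0 < τ k) {τm : ℝ} (hτm0 : 0 ≤ τm)
    (hτm : ∀ k, 1 ≤ k → k ≤ N → τ k ≤ τm) {ξ : ℕ → H} {X C : ℝ} (hC : 0 ≤ C)
    (h1 : ‖ξ 1‖ ≤ X) (h2 : ∀ k, 2 ≤ k → k ≤ N → ‖ξ k‖ ≤ C) {n : ℕ} (hn : n ≤ N) :
    ∑ k ∈ range n, ‖docTransform θ τ ξ (k + 1)‖ ≤
      C * ∑ k ∈ range n, τ (k + 1) + 2 * θ * τm * X := by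
  have hX : 0 ≤ X := (norm_nonneg _).trans h1
  set q := (2 * θ - 1) / (2 * θ) with hq
  have hq0 : 0 ≤ q := div_nonneg (by linarith) (by linarith)
  have hq1 : 2 * θ * (1 - q) = 1 := by rw [hq]; field_simp; ring
  have hgeom : ∑ k ∈ range n, q ^ k ≤ 2 * θ := by
    have h := geom_sum_mul_neg q n
    nlinarith [pow_nonneg hq0 n]
  calc ∑ k ∈ range n, ‖docTransform θ τ ξ (k + 1)‖
      ≤ ∑ k ∈ range n, (C * τ (k + 1) + τm * X * q ^ k) := by
        refine sum_le_sum fun k hk => ?_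
        have hk := mem_range.mp hk
        refine (norm_docTransform_le hθ hτ hC h1 h2 (by omega : k + 1 ≤ N)).trans ?_
        have := mul_le_mul_of_nonneg_right (hτm (k + 1) (by omega) (by omega))
          (mul_nonneg (pow_nonneg hq0 k) hX)
        linarith
    _ = C * ∑ k ∈ range n, τ (k + 1) + τm * X * ∑ k ∈ range n, q ^ k := by
        rw [sum_add_distrib, mul_sum, mul_sum]
    _ ≤ C * ∑ k ∈ range n, τ (k + 1) + τm * X * (2 * θ) := by gcongr
    _ = _ := by ring

end Stability

section Consistency

variable {E : Type*} [NormedAddCommGroup E] [NormedSpace ℝ E]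

/-- The mean value inequality with a derivative bound only between the two points. -/
theorem norm_sub_le_of_hasDerivWithinAt_uIcc {g g' : ℝ → E} {a b c x K : ℝ}
    (hg : ∀ y ∈ Set.Icc a b, HasDerivWithinAt g (g' y) (Set.Icc a b) y)
    (hc : c ∈ Set.Icc a b) (hx : x ∈ Set.Icc a b) (hK : ∀ y ∈ Set.uIcc c x, ‖g' y‖ ≤ K) :
    ‖g x - g c‖ ≤ K * |x - c| := by
  have hsub : Set.uIcc c x ⊆ Set.Icc a b := Set.uIcc_subset_Icc hc hx
  exact (convex_uIcc c x).norm_image_sub_le_of_norm_hasDerivWithin_le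
    (fun y hy => (hg y (hsub hy)).mono hsub) hK Set.left_mem_uIcc Set.right_mem_uIcc

theorem norm_taylor_one_le {u₁ u₂ u₃ : ℝ → E} {a b M : ℝ}
    (h₁ : ∀ y ∈ Set.Icc a b, HasDerivWithinAt u₁ (u₂ y) (Set.Icc a b) y)
    (h₂ : ∀ y ∈ Set.Icc a b, HasDerivWithinAt u₂ (u₃ y) (Set.Icc a b) y)
    (hM : ∀ y ∈ Set.Icc a b, ‖u₃ y‖ ≤ M) {c x : ℝ} (hc : c ∈ Set.Icc a b)
    (hx : x ∈ Set.Icc a b) : ‖u₁ x - u₁ c - (x - c) • u₂ c‖ ≤ M * |x - c| ^ 2 := by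
  have hM0 : 0 ≤ M := (norm_nonneg _).trans (hM c hc)
  have := norm_sub_le_of_hasDerivWithinAt_uIcc (g := fun y => u₁ y - (y - c) • u₂ c)
    (g' := fun y => u₂ y - u₂ c) (K := M * |x - c|)
    (fun y hy => by
      simpa using (h₁ y hy).fun_sub (((hasDerivWithinAt_id y _).sub_const c).smul_const (u₂ c)))
    hc hx (fun y hy =>
      (norm_sub_le_of_hasDerivWithinAt_uIcc h₂ hc (Set.uIcc_subset_Icc hc hx hy)
        (fun z hz => hM z (Set.uIcc_subset_Icc hc (Set.uIcc_subset_Icc hc hx hy) hz))).trans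
      (mul_le_mul_of_nonneg_left (Set.abs_sub_left_of_mem_uIcc hy) hM0))
  refine le_of_eq_of_le ?_ (this.trans_eq (by ring))
  congr 1
  module

theorem norm_taylor_two_le {u₀ u₁ u₂ u₃ : ℝ → E} {a b M : ℝ}
    (h₀ : ∀ y ∈ Set.Icc a b, HasDerivWithinAt u₀ (u₁ y) (Set.Icc a b) y)
    (h₁ : ∀ y ∈ Set.Icc a b, HasDerivWithinAt u₁ (u₂ y) (Set.Icc a b) y)
    (h₂ : ∀ y ∈ Set.Icc a b, HasDerivWithinAt u₂ (u₃ y) (Set.Icc a b) y)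
    (hM : ∀ y ∈ Set.Icc a b, ‖u₃ y‖ ≤ M) {c x : ℝ} (hc : c ∈ Set.Icc a b)
    (hx : x ∈ Set.Icc a b) :
    ‖u₀ x - u₀ c - (x - c) • u₁ c - ((x - c) ^ 2 / 2) • u₂ c‖ ≤ M * |x - c| ^ 3 := by
  have hM0 : 0 ≤ M := (norm_nonneg _).trans (hM c hc)
  have := norm_sub_le_of_hasDerivWithinAt_uIcc
    (g := fun y => u₀ y - (y - c) • u₁ c - ((y - c) ^ 2 / 2) • u₂ c)
    (g' := fun y => u₁ y - u₁ c - (y - c) • u₂ c) (K := M * |x - c| ^ 2)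
    (fun y hy => by
      have hd := (hasDerivWithinAt_id y (Set.Icc a b)).sub_const c
      have := ((h₀ y hy).fun_sub (hd.smul_const (u₁ c))).fun_sub
        (((hd.fun_pow 2).div_const 2).smul_const (u₂ c))
      simpa using this)
    hc hx (fun y hy => (norm_taylor_one_le h₁ h₂ hM hc (Set.uIcc_subset_Icc hc hx hy)).trans
      (by gcongr M * ?_ ^ 2; exact Set.abs_sub_left_of_mem_uIcc hy))
  refine le_of_eq_of_le ?_ (this.trans_eq (by ring))
  congr 1
  module

/-- The truncation error of the weighted one-step scheme. -/
theorem norm_one_step_truncation_le {u₀ u₁ u₂ : ℝ → E} {a b M θ : ℝ}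
    (h₀ : ∀ y ∈ Set.Icc a b, HasDerivWithinAt u₀ (u₁ y) (Set.Icc a b) y)
    (h₁ : ∀ y ∈ Set.Icc a b, HasDerivWithinAt u₁ (u₂ y) (Set.Icc a b) y)
    (hθ : 1 / 2 ≤ θ ∧ θ ≤ 1) {c x : ℝ} (hcx : c ≤ x) (hc : c ∈ Set.Icc a b)
    (hx : x ∈ Set.Icc a b) (hM : ∀ y ∈ Set.Icc c x, ‖u₂ y‖ ≤ M) :
    ‖u₀ x - u₀ c - (x - c) • (θ • u₁ x + (1 - θ) • u₁ c)‖ ≤ θ * (x - c) ^ 2 * M := by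
  obtain ⟨hθ1, hθ2⟩ := hθ
  have hM0 : 0 ≤ M := (norm_nonneg _).trans (hM c ⟨le_rfl, hcx⟩)
  have hsub : Set.Icc c x ⊆ Set.Icc a b := Set.Icc_subset_Icc hc.1 hx.2
  have := norm_sub_le_of_hasDerivWithinAt_uIcc
    (g := fun y => u₀ y - (y - c) • (θ • u₁ x + (1 - θ) • u₁ c))
    (g' := fun y => u₁ y - (θ • u₁ x + (1 - θ) • u₁ c)) (K := θ * (x - c) * M)
    (fun y hy => by
      simpa using (h₀ y hy).fun_sub (((hasDerivWithinAt_id y _).sub_const c).smul_const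
        (θ • u₁ x + (1 - θ) • u₁ c)))
    hc hx (fun y hy => by
      rw [Set.uIcc_of_le hcx] at hy
      have hbx := norm_sub_le_of_hasDerivWithinAt_uIcc h₁ hx (hsub hy) (K := M) (fun z hz => by
        rw [Set.uIcc_of_ge hy.2] at hz
        exact hM z ⟨hy.1.trans hz.1, hz.2⟩)
      have hbc := norm_sub_le_of_hasDerivWithinAt_uIcc h₁ hc (hsub hy) (K := M) (fun z hz => by
        rw [Set.uIcc_of_le hy.1] at hz
        exact hM z ⟨hz.1, hz.2.trans hy.2⟩)
      rw [abs_of_nonpos (by linarith [hy.2])] at hbx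
      rw [abs_of_nonneg (by linarith [hy.1])] at hbc
      calc ‖u₁ y - (θ • u₁ x + (1 - θ) • u₁ c)‖
          = ‖θ • (u₁ y - u₁ x) + (1 - θ) • (u₁ y - u₁ c)‖ := by congr 1; module
        _ ≤ θ * ‖u₁ y - u₁ x‖ + (1 - θ) * ‖u₁ y - u₁ c‖ := by
            refine (norm_add_le _ _).trans_eq ?_
            rw [norm_smul, norm_smul, Real.norm_of_nonneg (by linarith),
              Real.norm_of_nonneg (by linarith)]
        _ ≤ θ * (M * -(y - x)) + (1 - θ) * (M * (y - c)) := by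
            gcongr
        _ ≤ θ * (x - c) * M := by
            nlinarith [mul_nonneg hM0 (mul_nonneg (by linarith : 0 ≤ 2 * θ - 1)
              (sub_nonneg.mpr hy.1))])
  rw [abs_of_nonneg (by linarith)] at this
  refine le_of_eq_of_le ?_ (this.trans_eq (by ring))
  congr 1
  module

theorem bk_remainder_le {θ : ℝ} (hθ : 1 / 2 ≤ θ ∧ θ ≤ 1) {τ : ℕ → ℝ} {n : ℕ} (hn : 2 ≤ n)
    (hτ : 0 < τ n) (hτ' : 0 < τ (n - 1)) {τm : ℝ} (hle : τ n ≤ τm) (hle' : τ (n - 1) ≤ τm) :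
    bk θ τ n 0 * τ n ^ 3 + -bk θ τ n 1 * τ (n - 1) ^ 3 + θ * τ n ^ 2 ≤ 3 * τm ^ 2 := by
  obtain ⟨h1, h2⟩ := hθ
  rw [bk_zero_of_two_le hn, bk_one_of_two_le hn, rr]
  generalize τ n = h at *
  generalize τ (n - 1) = k at *
  have : (1 + 2 * θ * (h / k)) / (h * (1 + h / k)) * h ^ 3 +
      -((1 - 2 * θ) * (h / k) ^ 2 / (h * (1 + h / k))) * k ^ 3 + θ * h ^ 2
      = ((k + 2 * θ * h) * h ^ 2 + (2 * θ - 1) * (h * k ^ 2) + θ * (h ^ 2 * (h + k))) /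
        (h + k) := by
    field_simp
    ring
  rw [this, div_le_iff₀ (by positivity)]
  have e1 : h ^ 2 ≤ τm ^ 2 := by gcongr
  have e2 : h * k ≤ τm ^ 2 := by rw [sq]; exact mul_le_mul hle hle' hτ'.le (hτ.le.trans hle)
  calc (k + 2 * θ * h) * h ^ 2 + (2 * θ - 1) * (h * k ^ 2) + θ * (h ^ 2 * (h + k))
      ≤ (k + 2 * 1 * h) * h ^ 2 + (2 * 1 - 1) * (h * k ^ 2) + 1 * (h ^ 2 * (h + k)) := by gcongr
    _ = h ^ 2 * (3 * h + 2 * k) + h * k * k := by ring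
    _ ≤ τm ^ 2 * (3 * h + 2 * k) + τm ^ 2 * k := by gcongr
    _ = _ := by ring

/-- The truncation error of the two-step scheme is of second order. -/
theorem norm_two_step_truncation_le {u₀ u₁ u₂ u₃ : ℝ → E} {a b M θ : ℝ}
    (h₀ : ∀ y ∈ Set.Icc a b, HasDerivWithinAt u₀ (u₁ y) (Set.Icc a b) y)
    (h₁ : ∀ y ∈ Set.Icc a b, HasDerivWithinAt u₁ (u₂ y) (Set.Icc a b) y)
    (h₂ : ∀ y ∈ Set.Icc a b, HasDerivWithinAt u₂ (u₃ y) (Set.Icc a b) y)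
    (hM : ∀ y ∈ Set.Icc a b, ‖u₃ y‖ ≤ M) (hθ : 1 / 2 ≤ θ ∧ θ ≤ 1) {τ : ℕ → ℝ} {n : ℕ}
    (hn : 2 ≤ n) (hτ : 0 < τ n) (hτ' : 0 < τ (n - 1)) {τm : ℝ} (hle : τ n ≤ τm)
    (hle' : τ (n - 1) ≤ τm) {x y z : ℝ} (hx : x ∈ Set.Icc a b) (hy : y ∈ Set.Icc a b)
    (hz : z ∈ Set.Icc a b) (hxy : τ n = x - y) (hyz : τ (n - 1) = y - z) :
    ‖bk θ τ n 0 • (u₀ x - u₀ y) + bk θ τ n 1 • (u₀ y - u₀ z)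
      - (θ • u₁ x + (1 - θ) • u₁ y)‖ ≤ 3 * M * τm ^ 2 := by
  have hM0 : 0 ≤ M := (norm_nonneg _).trans (hM x hx)
  have hr : 0 < rr τ n := div_pos hτ hτ'
  have hb0 := (bk_zero_pos (τ := τ) (by linarith [hθ.1] : 0 ≤ θ) (by omega) hτ fun _ => hr).le
  have hb1 := bk_one_nonpos hθ.1 hn hτ hr
  have c1 := bk_zero_mul_add (θ := θ) hn hτ hτ'
  have c2 := bk_zero_mul_sq_sub (θ := θ) hn hτ hτ'
  have hrem := bk_remainder_le hθ hn hτ hτ' hle hle'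
  have t1 := norm_taylor_two_le h₀ h₁ h₂ hM hy hx
  have t2 := norm_taylor_two_le h₀ h₁ h₂ hM hy hz
  have t3 := norm_taylor_one_le h₁ h₂ hM hy hx
  rw [← hxy, abs_of_pos hτ] at t1 t3
  rw [show z - y = -τ (n - 1) by linarith, abs_neg, abs_of_pos hτ'] at t2
  set R₁ := u₀ x - u₀ y - τ n • u₁ y - (τ n ^ 2 / 2) • u₂ y with hR₁
  set R₂ := u₀ z - u₀ y - (-τ (n - 1)) • u₁ y - ((-τ (n - 1)) ^ 2 / 2) • u₂ y with hR₂
  set R₃ := u₁ x - u₁ y - τ n • u₂ y with hR₃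
  have hdecomp : bk θ τ n 0 • (u₀ x - u₀ y) + bk θ τ n 1 • (u₀ y - u₀ z)
      - (θ • u₁ x + (1 - θ) • u₁ y) = bk θ τ n 0 • R₁ + -bk θ τ n 1 • R₂ - θ • R₃ := by
    have d1 := congrArg (· • u₁ y) c1
    have d2 := congrArg (· • ((1 / 2 : ℝ) • u₂ y)) c2
    rw [hR₁, hR₂, hR₃]
    linear_combination (norm := module) d1 + d2
  rw [hdecomp]
  calc ‖bk θ τ n 0 • R₁ + -bk θ τ n 1 • R₂ - θ • R₃‖
      ≤ bk θ τ n 0 * ‖R₁‖ + -bk θ τ n 1 * ‖R₂‖ + θ * ‖R₃‖ := by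
        refine (norm_sub_le _ _).trans ?_
        rw [norm_smul θ, Real.norm_of_nonneg (by linarith [hθ.1] : 0 ≤ θ)]
        gcongr
        refine (norm_add_le _ _).trans_eq ?_
        rw [norm_smul, norm_smul, Real.norm_of_nonneg hb0, Real.norm_of_nonneg (by linarith)]
    _ ≤ bk θ τ n 0 * (M * τ n ^ 3) + -bk θ τ n 1 * (M * τ (n - 1) ^ 3) +
        θ * (M * τ n ^ 2) := by
        have := hθ.1
        gcongr
        linarith
    _ = M * (bk θ τ n 0 * τ n ^ 3 + -bk θ τ n 1 * τ (n - 1) ^ 3 + θ * τ n ^ 2) := by ring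
    _ ≤ M * (3 * τm ^ 2) := by gcongr
    _ = _ := by ring

theorem ContDiffOn.hasDerivWithinAt_iteratedDerivWithin {u : ℝ → E} {s : Set ℝ} {n m : ℕ}
    (hu : ContDiffOn ℝ n u s) (hs : UniqueDiffOn ℝ s) (hm : m < n) {y : ℝ} (hy : y ∈ s) :
    HasDerivWithinAt (iteratedDerivWithin m u s) (iteratedDerivWithin (m + 1) u s y) s y := by
  rw [iteratedDerivWithin_succ]
  exact (hu.differentiableOn_iteratedDerivWithin (by exact_mod_cast hm) hs y hy).hasDerivWithinAt

theorem ContinuousOn.norm_le_sSup_image {F : Type*} [SeminormedAddCommGroup F] {g : ℝ → F}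
    {K : Set ℝ} (hK : IsCompact K)
    (hg : ContinuousOn g K) {y : ℝ} (hy : y ∈ K) : ‖g y‖ ≤ sSup ((fun s => ‖g s‖) '' K) :=
  le_csSup (hK.bddAbove_image hg.norm) ⟨y, hy, rfl⟩

end Consistency

/-- second-order convergence of the WSBDF2 scheme (Theorem 4.1). Let
`θ ∈ (1/2, 1]`, let all step ratios satisfy `0 < r_k ≤ r_s` (`r_s` the unique positive root
of `(1 − 2θ)² r³ − 4θ² r² − 4θ r − 1 = 0`), let `u : [0,T] → H` be three times continuously
differentiable with `u' + A u = f` on `[0,T]`, and let `U^0, …, U^N` be the WSBDF2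
approximations with `U^0 = u(0)` and data `f^k = f(t_k)`. Then, for `1 ≤ n ≤ N`,
`‖u(t_n) − U^n‖ ≤ 4(2 − θ) τ_max² max_{[0,t_1]} ‖u''‖ + 6 t_n τ_max² max_{[0,T]} ‖u'''‖`. -/
theorem wsbdf2_convergence
    {H : Type*} [NormedAddCommGroup H] [InnerProductSpace ℝ H] [CompleteSpace H]
    (A : H →L[ℝ] H)
    (hA_selfadj : ∀ x y : H, ⟪A x, y⟫ = ⟪x, A y⟫)
    (hA_nonneg : ∀ x : H, 0 ≤ ⟪A x, x⟫)
    (θ : ℝ) (hθ : 1 / 2 < θ ∧ θ ≤ 1)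
    (T : ℝ) (hT : 0 < T)
    (N : ℕ) (hN : 1 ≤ N)
    (t : ℕ → ℝ) (ht0 : t 0 = 0) (htN : t N = T)
    (htmono : ∀ k, 1 ≤ k → k ≤ N → t (k - 1) < t k)
    (τ : ℕ → ℝ) (hτdef : ∀ k, 1 ≤ k → k ≤ N → τ k = t k - t (k - 1))
    (rs : ℝ) (hrs_pos : 0 < rs)
    (hrs_root : (1 - 2 * θ) ^ 2 * rs ^ 3 - 4 * θ ^ 2 * rs ^ 2 - 4 * θ * rs - 1 = 0)
    (hrs_uniq : ∀ r : ℝ, 0 < r →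
      (1 - 2 * θ) ^ 2 * r ^ 3 - 4 * θ ^ 2 * r ^ 2 - 4 * θ * r - 1 = 0 → r = rs)
    (hr : ∀ k, 2 ≤ k → k ≤ N → 0 < rr τ k ∧ rr τ k ≤ rs)
    (u : ℝ → H) (hu : ContDiffOn ℝ 3 u (Set.Icc 0 T))
    (f : ℝ → H)
    (hODE : ∀ s ∈ Set.Icc (0 : ℝ) T, derivWithin u (Set.Icc 0 T) s + A (u s) = f s)
    (U : ℕ → H) (hU0 : U 0 = u 0)
    (hscheme1 : (τ 1)⁻¹ • (U 1 - U 0) + A (θ • U 1 + (1 - θ) • U 0)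
      = θ • f (t 1) + (1 - θ) • f (t 0))
    (hscheme : ∀ n, 2 ≤ n → n ≤ N →
      bk θ τ n 0 • (U n - U (n - 1)) + bk θ τ n 1 • (U (n - 1) - U (n - 2)) +
        A (θ • U n + (1 - θ) • U (n - 1)) = θ • f (t n) + (1 - θ) • f (t (n - 1))) :
    ∀ n, 1 ≤ n → n ≤ N →
      ‖u (t n) - U n‖ ≤
        4 * (2 - θ) * ((Finset.Icc 1 N).sup' (Finset.nonempty_Icc.mpr hN) τ) ^ 2 *
            sSup ((fun s => ‖iteratedDerivWithin 2 u (Set.Icc 0 T) s‖) '' Set.Icc 0 (t 1)) +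
          6 * t n * ((Finset.Icc 1 N).sup' (Finset.nonempty_Icc.mpr hN) τ) ^ 2 *
            sSup ((fun s => ‖iteratedDerivWithin 3 u (Set.Icc 0 T) s‖) '' Set.Icc 0 T) := by
  have hτ : ∀ k, 1 ≤ k → k ≤ N → 0 < τ k := fun k h h' => by
    rw [hτdef k h h']
    exact sub_pos.mpr (htmono k h h')
  set τm := (Finset.Icc 1 N).sup' (Finset.nonempty_Icc.mpr hN) τ
  have hτm : ∀ k, 1 ≤ k → k ≤ N → τ k ≤ τm := fun k h h' =>
    Finset.le_sup' τ (Finset.mem_Icc.mpr ⟨h, h'⟩)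
  have hτm0 : 0 ≤ τm := (hτ 1 le_rfl hN).le.trans (hτm 1 le_rfl hN)
  have hsum : ∀ n, n ≤ N → ∑ k ∈ range n, τ (k + 1) = t n := by
    intro n hn
    rw [← sub_zero (t n), ← ht0, ← sum_range_sub]
    refine sum_congr rfl fun k hk => ?_
    simpa using hτdef (k + 1) (by omega) (by have := mem_range.mp hk; omega)
  have hmono : ∀ i j, i ≤ j → j ≤ N → t i ≤ t j := by
    intro i j hij
    induction j, hij using Nat.le_induction with
    | base => intro _; exact le_rfl
    | succ j _ ih =>
      intro hj
      exact (ih (by omega)).trans (htmono (j + 1) (by omega) hj).le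
  have ht : ∀ k, k ≤ N → t k ∈ Set.Icc 0 T := fun k hk =>
    ⟨ht0 ▸ hmono 0 k (by omega) hk, htN ▸ hmono k N hk le_rfl⟩
  have hS : UniqueDiffOn ℝ (Set.Icc 0 T) := uniqueDiffOn_Icc hT
  set S := Set.Icc 0 T
  have hu' : ContDiffOn ℝ (3 : ℕ) u S := hu
  have d₀ : ∀ y ∈ S, HasDerivWithinAt u (derivWithin u S y) S y := fun y hy => by
    simpa using hu'.hasDerivWithinAt_iteratedDerivWithin hS (m := 0) (by norm_num) hy
  have d₁ : ∀ y ∈ S, HasDerivWithinAt (derivWithin u S) (iteratedDerivWithin 2 u S y) S y :=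
    fun y hy => by
      simpa using hu'.hasDerivWithinAt_iteratedDerivWithin hS (m := 1) (by norm_num) hy
  have d₂ : ∀ y ∈ S, HasDerivWithinAt (iteratedDerivWithin 2 u S)
      (iteratedDerivWithin 3 u S y) S y := fun y hy =>
    hu'.hasDerivWithinAt_iteratedDerivWithin hS (m := 2) (by norm_num) hy
  set M₂ := sSup ((fun s => ‖iteratedDerivWithin 2 u S s‖) '' Set.Icc 0 (t 1))
  set M₃ := sSup ((fun s => ‖iteratedDerivWithin 3 u S s‖) '' S)
  have hM₂ : ∀ y ∈ Set.Icc 0 (t 1), ‖iteratedDerivWithin 2 u S y‖ ≤ M₂ := fun y hy =>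
    ContinuousOn.norm_le_sSup_image isCompact_Icc
      ((hu'.continuousOn_iteratedDerivWithin (m := 2) (by norm_num) hS).mono
        (Set.Icc_subset_Icc le_rfl (ht 1 hN).2)) hy
  have hM₃ : ∀ y ∈ S, ‖iteratedDerivWithin 3 u S y‖ ≤ M₃ := fun y hy =>
    ContinuousOn.norm_le_sSup_image isCompact_Icc
      (hu'.continuousOn_iteratedDerivWithin (m := 3) le_rfl hS) hy
  have hM₂0 : 0 ≤ M₂ := (norm_nonneg _).trans (hM₂ 0 ⟨le_rfl, (ht 1 hN).1⟩)
  have hM₃0 : 0 ≤ M₃ := (norm_nonneg _).trans (hM₃ 0 ⟨le_rfl, hT.le⟩)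
  set ξ : ℕ → H := fun n => bk θ τ n 0 • (u (t n) - u (t (n - 1)))
    + bk θ τ n 1 • (u (t (n - 1)) - u (t (n - 2)))
    - (θ • derivWithin u S (t n) + (1 - θ) • derivWithin u S (t (n - 1))) with hξ
  have hξ1 : ‖ξ 1‖ ≤ θ * τm * M₂ := by
    have hp := hτ 1 le_rfl hN
    have hd := hτdef 1 le_rfl hN
    simp only [Nat.sub_self, ht0, sub_zero] at hd
    have h := norm_one_step_truncation_le d₀ d₁ ⟨hθ.1.le, hθ.2⟩ (ht 1 hN).1
      ⟨le_rfl, hT.le⟩ (ht 1 hN) hM₂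
    rw [sub_zero, ← hd] at h
    have he : ξ 1 = (τ 1)⁻¹ • (u (τ 1) - u 0
        - τ 1 • (θ • derivWithin u S (τ 1) + (1 - θ) • derivWithin u S 0)) := by
      rw [smul_sub, inv_smul_smul₀ hp.ne']
      simp [hξ, bk_one_zero, bk_one_one, ht0, ← hd]
    rw [he, norm_smul, norm_inv, Real.norm_of_nonneg hp.le, inv_mul_le_iff₀ hp]
    refine h.trans ?_
    have := mul_le_mul_of_nonneg_left (hτm 1 le_rfl hN)
      (by have := hθ.1; positivity : 0 ≤ θ * τ 1 * M₂)
    linarith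
  have hξ2 : ∀ k, 2 ≤ k → k ≤ N → ‖ξ k‖ ≤ 3 * M₃ * τm ^ 2 := fun k h2 hk =>
    norm_two_step_truncation_le d₀ d₁ d₂ hM₃ ⟨hθ.1.le, hθ.2⟩ h2 (hτ k (by omega) hk)
      (hτ (k - 1) (by omega) (by omega)) (hτm k (by omega) hk)
      (hτm (k - 1) (by omega) (by omega)) (ht k hk) (ht (k - 1) (by omega))
      (ht (k - 2) (by omega)) (hτdef k (by omega) hk)
      (hτdef (k - 1) (by omega) (by omega))
  have hscheme' : ∀ n, n + 1 ≤ N → bk θ τ (n + 1) 0 • (U (n + 1) - U n)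
      + bk θ τ (n + 1) 1 • (U n - U (n - 1)) + A (θ • U (n + 1) + (1 - θ) • U n)
      = θ • f (t (n + 1)) + (1 - θ) • f (t n) := by
    intro n hn
    rcases Nat.eq_zero_or_pos n with rfl | hn0
    · simpa [bk_one_zero, bk_one_one] using hscheme1
    · simpa using hscheme (n + 1) (by omega) hn
  have herr : ∀ n, n + 1 ≤ N →
      bk θ τ (n + 1) 0 • ((u (t (n + 1)) - U (n + 1)) - (u (t n) - U n))
      + bk θ τ (n + 1) 1 • ((u (t n) - U n) - (u (t (n - 1)) - U (n - 1)))
      + A (θ • (u (t (n + 1)) - U (n + 1)) + (1 - θ) • (u (t n) - U n)) = ξ (n + 1) := by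
    intro n hn
    have h := hscheme' n hn
    rw [← hODE _ (ht (n + 1) hn), ← hODE _ (ht n (by omega))] at h
    simp only [hξ, Nat.add_sub_cancel, show n + 1 - 2 = n - 1 by omega, map_add, map_sub,
      map_smul] at h ⊢
    linear_combination (norm := module) -h
  intro n _ hn
  have hstab := norm_le_two_mul_sum_docTransform hθ hτ hrs_pos hrs_root hr A hA_selfadj hA_nonneg
    (e := fun k => u (t k) - U k) (by simp [ht0, hU0]) herr hn
  have hdoc := sum_norm_docTransform_le hθ.1.le hτ hτm0 hτm
    (by positivity : 0 ≤ 3 * M₃ * τm ^ 2) hξ1 hξ2 hn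
  rw [hsum n hn] at hdoc
  have hθ2 : 4 * θ ^ 2 ≤ 4 * (2 - θ) := by nlinarith [hθ.1, hθ.2]
  have := mul_le_mul_of_nonneg_right hθ2 (by positivity : 0 ≤ τm ^ 2 * M₂)
  linarith
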